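/- Let f : [0,∞) → ℝ be operator convex, let Φ_1,…,Φ_n be positive linear maps from bounded operators on H to bounded operators on K with ∑_{i=1}^n Φ_i(I) = I and each Φ_i(I) invertible, and let A_1,…,A_n be positive operators on H. Let {1,…,n} = S_1 ∪ S_2 be a partition into two disjoint nonempty sets and set D_k = ∑_{i∈S_k} Φ_i(I) (k = 1,2), assumed invertible. Then the following chain of Loewner-order inequalities holds: f(∑_{i=1}^n Φ_i(A_i)) ≤ D_1^{1/2} f(D_1^{−1/2} (∑_{i∈S_1} Φ_i(A_i)) D_1^{−1/2}) D_1^{1/2} + D_2^{1/2} f(D_2^{−1/2} (∑_{i∈S_2} Φ_i(A_i)) D_2^{−1/2}) D_2^{1/2} ≤ ∑_{i=1}^n Φ_i(I)^{1/2} f(Φ_i(I)^{−1/2} Φ_i(A_i) Φ_i(I)^{−1/2}) Φ_i(I)^{1/2} ≤ ∑_{i=1}^n Φ_i(f(A_i)). This refines the Choi–Davis–Jensen inequality f(∑Φ_i(A_i)) ≤ ∑Φ_i(f(A_i)). -/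

import Mathlib

open scoped InnerProductSpace

noncomputable section

/-- A continuous function `f : [0, ∞) → ℝ` is *operator convex* if for every complex Hilbert
space `K`, all selfadjoint operators `A, B` on `K` with spectra in `[0, ∞)` and every
`λ ∈ [0, 1]` one has `f(λA + (1-λ)B) ≤ λ f(A) + (1-λ) f(B)` in the Loewner order, where
`f(A)` is given by the continuous functional calculus. -/
def OperatorConvexOn (f : ℝ → ℝ) : Prop :=
  ∀ (K : Type) [NormedAddCommGroup K] [InnerProductSpace ℂ K] [CompleteSpace K],
    ∀ A B : K →L[ℂ] K, IsSelfAdjoint A → IsSelfAdjoint B →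
      spectrum ℝ A ⊆ Set.Ici (0 : ℝ) → spectrum ℝ B ⊆ Set.Ici (0 : ℝ) →
      ∀ lam : ℝ, lam ∈ Set.Icc (0 : ℝ) 1 →
        cfc f (lam • A + (1 - lam) • B) ≤ lam • cfc f A + (1 - lam) • cfc f B

variable {H : Type} [NormedAddCommGroup H] [InnerProductSpace ℂ H] [CompleteSpace H]

/-- `R^{1/2}` via the continuous functional calculus. -/
def opSqrt (R : H →L[ℂ] H) : H →L[ℂ] H := cfc Real.sqrt R

/-- `R^{-1/2}` via the continuous functional calculus. -/
def opInvSqrt (R : H →L[ℂ] H) : H →L[ℂ] H := cfc (fun t : ℝ => (Real.sqrt t)⁻¹) R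

/-- The non-commutative perspective `g(L, R) = R^{1/2} f(R^{-1/2} L R^{-1/2}) R^{1/2}`. -/
def persp (f : ℝ → ℝ) (L R : H →L[ℂ] H) : H →L[ℂ] H :=
  opSqrt R * cfc f (opInvSqrt R * L * opInvSqrt R) * opSqrt R

theorem spectrum_subset_Ici_of_nonneg {E : Type*} [NormedAddCommGroup E] [InnerProductSpace ℂ E]
    [CompleteSpace E] {A : E →L[ℂ] E} (hA : 0 ≤ A) : spectrum ℝ A ⊆ Set.Ici 0 :=
  fun _ hx => spectrum_nonneg_of_nonneg hA hx

open ContinuousLinearMap in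
/-- The continuous functional calculus respects intertwiners of positive operators. -/
theorem cfc_comp_eq_comp_cfc {E F : Type*}
    [NormedAddCommGroup E] [InnerProductSpace ℂ E] [CompleteSpace E]
    [NormedAddCommGroup F] [InnerProductSpace ℂ F] [CompleteSpace F]
    {f : ℝ → ℝ} (hf : ContinuousOn f (Set.Ici 0))
    {A : E →L[ℂ] E} {B : F →L[ℂ] F} (hA : 0 ≤ A) (hB : 0 ≤ B) (V : E →L[ℂ] F)
    (h : B ∘L V = V ∘L A) : cfc f B ∘L V = V ∘L cfc f A := by
  have hp : ∀ p : Polynomial ℝ, cfc p.eval B ∘L V = V ∘L cfc p.eval A := by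
    intro p
    rw [cfc_polynomial p A, cfc_polynomial p B]
    induction p using Polynomial.induction_on' with
    | add p q hp hq => simp [add_comp, comp_add, hp, hq]
    | monomial n a =>
      have hn : (B ^ n) ∘L V = V ∘L (A ^ n) := by
        induction n with
        | zero => simp [one_def]
        | succ n ih =>
          rw [pow_succ, pow_succ', mul_def, comp_assoc, h, ← comp_assoc, ih, comp_assoc,
            ← mul_def, ← pow_succ, pow_succ']
      simp [Polynomial.aeval_monomial, Algebra.algebraMap_eq_smul_one, smul_comp, comp_smul, hn]
  set M : ℝ := max (‖A‖ * ‖(1 : E →L[ℂ] E)‖) (‖B‖ * ‖(1 : F →L[ℂ] F)‖)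
  have hAM : ∀ x ∈ spectrum ℝ A, x ∈ Set.Icc 0 M := fun x hx =>
    ⟨spectrum_subset_Ici_of_nonneg hA hx, (le_abs_self x).trans
      ((spectrum.norm_le_norm_mul_of_mem hx).trans (le_max_left _ _))⟩
  have hBM : ∀ x ∈ spectrum ℝ B, x ∈ Set.Icc 0 M := fun x hx =>
    ⟨spectrum_subset_Ici_of_nonneg hB hx, (le_abs_self x).trans
      ((spectrum.norm_le_norm_mul_of_mem hx).trans (le_max_right _ _))⟩
  have hfA : ContinuousOn f (spectrum ℝ A) := hf.mono (spectrum_subset_Ici_of_nonneg hA)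
  have hfB : ContinuousOn f (spectrum ℝ B) := hf.mono (spectrum_subset_Ici_of_nonneg hB)
  have hbound : ∀ ε > 0, ‖cfc f B ∘L V - V ∘L cfc f A‖ ≤ ε * (2 * ‖V‖) := by
    intro ε hε
    obtain ⟨p, hpε⟩ := exists_polynomial_near_of_continuousOn 0 M f
      (hf.mono Set.Icc_subset_Ici_self) ε hε
    have hA' : ‖cfc p.eval A - cfc f A‖ ≤ ε := by
      rw [← cfc_sub p.eval f A]
      exact norm_cfc_le hε.le fun x hx => (hpε x (hAM x hx)).le
    have hB' : ‖cfc p.eval B - cfc f B‖ ≤ ε := by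
      rw [← cfc_sub p.eval f B]
      exact norm_cfc_le hε.le fun x hx => (hpε x (hBM x hx)).le
    have hsplit : cfc f B ∘L V - V ∘L cfc f A =
        V ∘L (cfc p.eval A - cfc f A) - (cfc p.eval B - cfc f B) ∘L V := by
      rw [comp_sub, sub_comp, hp]
      abel
    rw [hsplit]
    calc _ ≤ ‖V‖ * ε + ε * ‖V‖ := (norm_sub_le _ _).trans (add_le_add
            ((opNorm_comp_le _ _).trans (by gcongr)) ((opNorm_comp_le _ _).trans (by gcongr)))
      _ = ε * (2 * ‖V‖) := by ring
  have hlim : Filter.Tendsto (fun ε : ℝ => ε * (2 * ‖V‖)) (nhdsWithin 0 (Set.Ioi 0)) (nhds 0) := by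
    have : Continuous fun ε : ℝ => ε * (2 * ‖V‖) := by fun_prop
    simpa using (this.tendsto 0).mono_left nhdsWithin_le_nhds
  have := ge_of_tendsto hlim (Filter.eventually_of_mem self_mem_nhdsWithin hbound)
  exact sub_eq_zero.1 (norm_le_zero_iff.1 this)

open ContinuousLinearMap in
/-- Jensen's operator inequality for compressions by an isometry. -/
theorem OperatorConvexOn.cfc_compression_le {f : ℝ → ℝ} (hf : OperatorConvexOn f)
    (hf_cont : ContinuousOn f (Set.Ici 0)) {E F : Type}
    [NormedAddCommGroup E] [InnerProductSpace ℂ E] [CompleteSpace E]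
    [NormedAddCommGroup F] [InnerProductSpace ℂ F] [CompleteSpace F]
    (V : E →L[ℂ] F) (hV : adjoint V ∘L V = 1) {A : F →L[ℂ] F} (hA : 0 ≤ A) :
    cfc f (adjoint V ∘L A ∘L V) ≤ adjoint V ∘L cfc f A ∘L V := by
  have hV' (x : E) : adjoint V (V x) = x := DFunLike.congr_fun hV x
  set W : F →L[ℂ] F := V ∘L adjoint V + V ∘L adjoint V - 1 with hW
  have hWsa : IsSelfAdjoint W := by
    rw [isSelfAdjoint_iff', hW, map_sub, map_add, adjoint_comp, adjoint_adjoint,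
      ← star_eq_adjoint 1, star_one]
  have hWx (x : F) : W x = V (adjoint V x) + V (adjoint V x) - x := rfl
  have hconj (T : F →L[ℂ] F) (x : F) : (W * T * W) x = W (T (W x)) := rfl
  have hWV (x : E) : W (V x) = V x := by simp [hWx, hV']
  have hVW (x : F) : adjoint V (W x) = adjoint V x := by simp [hWx, hV']
  have hWW : W * W = 1 := by
    ext x
    change W (W x) = x
    rw [hWx (W x), hVW, hWx x]
    abel
  have hA' : 0 ≤ W * A * W := hWsa.conjugate_nonneg hA
  have hT : 0 ≤ adjoint V ∘L A ∘L V := by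
    rw [nonneg_iff_isPositive] at hA ⊢
    exact hA.adjoint_conj V
  have hcW : cfc f (W * A * W) = W * cfc f A * W := by
    have := cfc_comp_eq_comp_cfc hf_cont hA hA' W
      (by rw [← mul_def, ← mul_def, mul_assoc, hWW, mul_one])
    rw [← mul_def, ← mul_def] at this
    rw [← this, mul_assoc _ W W, hWW, mul_one]
  set B : F →L[ℂ] F := (1 / 2 : ℝ) • A + (1 - 1 / 2 : ℝ) • (W * A * W) with hB
  have hB0 : 0 ≤ B :=
    add_nonneg (smul_nonneg (by norm_num) hA) (smul_nonneg (by norm_num) hA')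
  have hBV : B ∘L V = V ∘L (adjoint V ∘L A ∘L V) := by
    ext x
    simp only [hB, comp_apply, add_apply, smul_apply, hconj, hWV]
    rw [hWx]
    module
  have key := hf F A (W * A * W) (.of_nonneg hA) (.of_nonneg hA')
    (spectrum_subset_Ici_of_nonneg hA) (spectrum_subset_Ici_of_nonneg hA') (1 / 2)
    (by constructor <;> norm_num)
  rw [← hB, hcW, le_def] at key
  have hBf := cfc_comp_eq_comp_cfc hf_cont hT hB0 V hBV
  have key2 := key.adjoint_conj V
  rw [le_def]
  convert key2 using 1
  ext x
  have hBfx : cfc f B (V x) = V (cfc f (adjoint V ∘L A ∘L V) x) := DFunLike.congr_fun hBf x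
  simp only [comp_apply, sub_apply, add_apply, smul_apply, hconj, hWV, hBfx, map_sub, map_add,
    map_smul_of_tower, hVW, hV']
  module

open ContinuousLinearMap in
/-- **Jensen's operator inequality** for families of operators. -/
theorem OperatorConvexOn.cfc_sum_conj_le {f : ℝ → ℝ} (hf : OperatorConvexOn f)
    (hf_cont : ContinuousOn f (Set.Ici 0)) {ι : Type} [Fintype ι] (C A : ι → H →L[ℂ] H)
    (hA : ∀ i, 0 ≤ A i) (hC : ∑ i, star (C i) * C i = 1) :
    cfc f (∑ i, star (C i) * A i * C i) ≤ ∑ i, star (C i) * cfc f (A i) * C i := by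
  classical
  let L := PiLp 2 (fun _ : ι => H)
  let π : ι → L →L[ℂ] H := fun i => PiLp.proj 2 (fun _ : ι => H) i
  have hπ (i j : ι) (x : H) : π i (adjoint (π j) x) = if i = j then x else 0 := by
    have hsingle : adjoint (π j) x = PiLp.single 2 j x := by
      refine ext_inner_left ℂ fun v => ?_
      rw [adjoint_inner_right]
      refine Eq.trans ?_ (PiLp.inner_apply (𝕜 := ℂ) v (PiLp.single 2 j x)).symm
      simp only [PiLp.single_apply]
      rw [Finset.sum_eq_single j (fun i _ hi => by simp [hi]) (by simp)]
      simp only [if_true]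
      rfl
    rw [hsingle]
    exact PiLp.single_apply 2 H j x i
  set V : H →L[ℂ] L := ∑ i, adjoint (π i) ∘L C i with hV
  set D : L →L[ℂ] L := ∑ i, adjoint (π i) ∘L A i ∘L π i with hD
  have hπV (i : ι) : π i ∘L V = C i := by
    ext x
    simp [hV, sum_apply, hπ]
  have hVadj : adjoint V = ∑ i, star (C i) ∘L π i := by
    simp [hV, map_sum, adjoint_comp, star_eq_adjoint]
  have hVV : adjoint V ∘L V = 1 := by
    rw [hVadj, finsetSum_comp, ← hC]
    simp_rw [comp_assoc, hπV, mul_def]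
  have hAi (i : ι) : 0 ≤ adjoint (π i) ∘L A i ∘L π i := by
    have := hA i
    rw [nonneg_iff_isPositive] at this ⊢
    exact this.adjoint_conj (π i)
  have hD0 : 0 ≤ D := Finset.sum_nonneg fun i _ => hAi i
  have hDπ (i : ι) : D ∘L adjoint (π i) = adjoint (π i) ∘L A i := by
    ext1 x
    simp only [hD, comp_apply, sum_apply, hπ, apply_ite, map_zero]
    simp
  have hDf (i : ι) : cfc f D ∘L adjoint (π i) = adjoint (π i) ∘L cfc f (A i) :=
    cfc_comp_eq_comp_cfc hf_cont (hA i) hD0 _ (hDπ i)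
  have hcompress {T : L →L[ℂ] L} {B : ι → H →L[ℂ] H}
      (hT : ∀ i, T ∘L adjoint (π i) = adjoint (π i) ∘L B i) :
      adjoint V ∘L T ∘L V = ∑ i, star (C i) * B i * C i := by
    have hTV : T ∘L V = ∑ i, adjoint (π i) ∘L B i ∘L C i := by
      rw [hV, comp_finsetSum]
      simp_rw [← comp_assoc, hT]
    ext x
    simp [hTV, hVadj, sum_apply, hπ, apply_ite]
  rw [← hcompress hDπ, ← hcompress hDf]
  exact hf.cfc_compression_le hf_cont V hVV hD0

section OpSqrt

variable {R : H →L[ℂ] H}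

theorem spectrum_pos_of_nonneg_of_isUnit (hR : 0 ≤ R) (hu : IsUnit R) :
    ∀ x ∈ spectrum ℝ R, 0 < x := fun _ hx =>
  (spectrum_nonneg_of_nonneg hR hx).lt_of_ne' fun h => spectrum.zero_notMem ℝ hu (h ▸ hx)

theorem continuousOn_inv_sqrt_spectrum (hR : 0 ≤ R) (hu : IsUnit R) :
    ContinuousOn (fun t : ℝ => (Real.sqrt t)⁻¹) (spectrum ℝ R) :=
  Real.continuous_sqrt.continuousOn.inv₀ fun x hx =>
    (Real.sqrt_pos.2 (spectrum_pos_of_nonneg_of_isUnit hR hu x hx)).ne'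

theorem isSelfAdjoint_opSqrt : IsSelfAdjoint (opSqrt R) := cfc_predicate _ _

theorem isSelfAdjoint_opInvSqrt : IsSelfAdjoint (opInvSqrt R) := cfc_predicate _ _

theorem opSqrt_mul_opSqrt (hR : 0 ≤ R) : opSqrt R * opSqrt R = R := by
  have hsa : IsSelfAdjoint R := .of_nonneg hR
  rw [opSqrt, ← cfc_mul Real.sqrt Real.sqrt R]
  conv_rhs => rw [← cfc_id' ℝ R]
  exact cfc_congr fun _ hx => Real.mul_self_sqrt (spectrum_nonneg_of_nonneg hR hx)

theorem opSqrt_mul_opInvSqrt (hR : 0 ≤ R) (hu : IsUnit R) : opSqrt R * opInvSqrt R = 1 := by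
  have hsa : IsSelfAdjoint R := .of_nonneg hR
  rw [opSqrt, opInvSqrt, ← cfc_mul Real.sqrt _ R (by fun_prop)
    (continuousOn_inv_sqrt_spectrum hR hu), ← cfc_one ℝ R]
  exact cfc_congr fun x hx => mul_inv_cancel₀
    (Real.sqrt_pos.2 (spectrum_pos_of_nonneg_of_isUnit hR hu x hx)).ne'

theorem opInvSqrt_mul_opSqrt (hR : 0 ≤ R) (hu : IsUnit R) : opInvSqrt R * opSqrt R = 1 := by
  rw [opInvSqrt, opSqrt, cfc_commute_cfc]
  exact opSqrt_mul_opInvSqrt hR hu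

theorem opInvSqrt_mul_self_mul_opInvSqrt (hR : 0 ≤ R) (hu : IsUnit R) :
    opInvSqrt R * R * opInvSqrt R = 1 := by
  nth_rewrite 2 [← opSqrt_mul_opSqrt hR]
  rw [← mul_assoc, opInvSqrt_mul_opSqrt hR hu, one_mul, opSqrt_mul_opInvSqrt hR hu]

theorem opSqrt_mul_opInvSqrt_conj (hR : 0 ≤ R) (hu : IsUnit R) (T : H →L[ℂ] H) :
    opSqrt R * (opInvSqrt R * T * opInvSqrt R) * opSqrt R = T := by
  rw [mul_assoc (opInvSqrt R), ← mul_assoc (opSqrt R), opSqrt_mul_opInvSqrt hR hu, one_mul,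
    mul_assoc, opInvSqrt_mul_opSqrt hR hu, mul_one]

theorem persp_one (f : ℝ → ℝ) (L : H →L[ℂ] H) : persp f L 1 = cfc f L := by
  have h₁ : opSqrt (1 : H →L[ℂ] H) = 1 := by simp [opSqrt, cfc_apply_one]
  have h₂ : opInvSqrt (1 : H →L[ℂ] H) = 1 := by simp [opInvSqrt, cfc_apply_one]
  simp [persp, h₁, h₂]

end OpSqrt

/-- The perspective of an operator convex function is subadditive. -/
theorem OperatorConvexOn.persp_sum_le {f : ℝ → ℝ} (hf : OperatorConvexOn f)
    (hf_cont : ContinuousOn f (Set.Ici 0)) {ι : Type} (s : Finset ι) (L R : ι → H →L[ℂ] H)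
    (hL : ∀ i, 0 ≤ L i) (hR : ∀ i, 0 ≤ R i) (hu : ∀ i, IsUnit (R i))
    (hus : IsUnit (∑ i ∈ s, R i)) :
    persp f (∑ i ∈ s, L i) (∑ i ∈ s, R i) ≤ ∑ i ∈ s, persp f (L i) (R i) := by
  have hD : 0 ≤ ∑ i ∈ s, R i := Finset.sum_nonneg fun i _ => hR i
  set D := ∑ i ∈ s, R i with hDdef
  let C : s → H →L[ℂ] H := fun i => opSqrt (R i) * opInvSqrt D
  have hCconj (i : s) (T : H →L[ℂ] H) : star (C i) * T * C i =
      opInvSqrt D * (opSqrt (R i) * T * opSqrt (R i)) * opInvSqrt D := by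
    simp only [C, star_mul, isSelfAdjoint_opSqrt.star_eq, isSelfAdjoint_opInvSqrt.star_eq,
      mul_assoc]
  have hsum (T : ι → H →L[ℂ] H) :
      ∑ i : s, star (C i) * T i * C i =
        opInvSqrt D * (∑ i ∈ s, opSqrt (R i) * T i * opSqrt (R i)) * opInvSqrt D := by
    simp_rw [hCconj, Finset.mul_sum, Finset.sum_mul]
    exact Finset.sum_coe_sort s
      fun i => opInvSqrt D * (opSqrt (R i) * T i * opSqrt (R i)) * opInvSqrt D
  have hC : ∑ i, star (C i) * C i = 1 := by
    have := hsum fun _ => 1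
    simp only [mul_one, opSqrt_mul_opSqrt (hR _)] at this
    rw [this, ← hDdef, opInvSqrt_mul_self_mul_opInvSqrt hD hus]
  have key := hf.cfc_sum_conj_le hf_cont C (fun i => opInvSqrt (R i) * L i * opInvSqrt (R i))
    (fun i => isSelfAdjoint_opInvSqrt.conjugate_nonneg (hL i)) hC
  rw [hsum fun i => opInvSqrt (R i) * L i * opInvSqrt (R i),
    hsum fun i => cfc f (opInvSqrt (R i) * L i * opInvSqrt (R i))] at key
  simp only [opSqrt_mul_opInvSqrt_conj (hR _) (hu _)] at key
  have := isSelfAdjoint_opSqrt (R := D).conjugate_le_conjugate key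
  rw [opSqrt_mul_opInvSqrt_conj hD hus] at this
  exact this

/-- **Choi–Davis–Jensen inequality** for unital positive linear maps. -/
theorem OperatorConvexOn.cfc_map_le {K : Type} [NormedAddCommGroup K] [InnerProductSpace ℂ K]
    [CompleteSpace K] {f : ℝ → ℝ} (hf : OperatorConvexOn f)
    (hf_cont : ContinuousOn f (Set.Ici 0)) (Ψ : (H →L[ℂ] H) →ₗ[ℂ] (K →L[ℂ] K))
    (hΨ : ∀ T, 0 ≤ T → 0 ≤ Ψ T) (hΨ1 : Ψ 1 = 1) {A : H →L[ℂ] H} (hA : 0 ≤ A) :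
    cfc f (Ψ A) ≤ Ψ (cfc f A) := by
  have hmono {S T : H →L[ℂ] H} (h : S ≤ T) : Ψ S ≤ Ψ T := by
    have := hΨ _ (sub_nonneg.2 h)
    rwa [map_sub, sub_nonneg] at this
  have hsa : IsSelfAdjoint A := .of_nonneg hA
  obtain ⟨M, hM, hAM⟩ : ∃ M : ℝ, 0 < M ∧ ∀ x ∈ spectrum ℝ A, x / M ∈ Set.Icc (0 : ℝ) 1 := by
    refine ⟨‖A‖ * ‖(1 : H →L[ℂ] H)‖ + 1, by positivity, fun x hx => ?_⟩
    have h0 : 0 ≤ x := spectrum_nonneg_of_nonneg hA hx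
    have h1 : x ≤ ‖A‖ * ‖(1 : H →L[ℂ] H)‖ :=
      (le_abs_self x).trans (spectrum.norm_le_norm_mul_of_mem hx)
    exact ⟨by positivity, (div_le_one (by positivity)).2 (by linarith)⟩
  have hfA : ContinuousOn f (spectrum ℝ A) := hf_cont.mono (spectrum_subset_Ici_of_nonneg hA)
  let g : C(unitInterval, ℝ) := ⟨fun t => f (M * t), hf_cont.comp_continuous (by fun_prop)
    fun t => mul_nonneg hM.le t.2.1⟩
  have happrox : ∀ ε > 0, cfc f (Ψ A) ≤ Ψ (cfc f A) + algebraMap ℝ (K →L[ℂ] K) ε := by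
    intro ε hε
    obtain ⟨n, hn, hn0⟩ := ((Metric.tendsto_nhds.1 (bernsteinApproximation_uniform g) ε hε).and
      (Filter.eventually_ne_atTop 0)).exists
    let e : Fin (n + 1) → ℝ → ℝ := fun k t => (bernsteinPolynomial ℝ n k).eval (t / M)
    have he_cont (k : Fin (n + 1)) : Continuous (e k) := by fun_prop
    let P : Fin (n + 1) → K →L[ℂ] K := fun k => Ψ (cfc (e k) A)
    have hP (k : Fin (n + 1)) : 0 ≤ P k := hΨ _ <| cfc_nonneg fun x hx => by
      have := bernstein_nonneg (n := n) (ν := k) (x := ⟨x / M, hAM x hx⟩)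
      simpa [e, bernstein] using this
    have hsum (c : Fin (n + 1) → ℝ) :
        ∑ k, c k • P k = Ψ (cfc (fun t => ∑ k, c k * e k t) A) := by
      have hcfc := cfc_sum_univ (fun k t => c k * e k t) A (fun k => by fun_prop)
      simp only [Finset.sum_fn] at hcfc
      rw [hcfc, map_sum]
      refine Finset.sum_congr rfl fun k _ => ?_
      rw [cfc_const_mul _ _ _ (by fun_prop), LinearMap.map_smul_of_tower]
    let t : Fin (n + 1) → ℝ := fun k => M * (k / n)
    have hP1 : ∑ k, P k = 1 := by
      have he (x : ℝ) : ∑ k, 1 * e k x = 1 := by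
        simp only [e, one_mul]
        rw [Fin.sum_univ_eq_sum_range fun k => (bernsteinPolynomial ℝ n k).eval (x / M),
          ← Polynomial.eval_finsetSum, bernsteinPolynomial.sum, Polynomial.eval_one]
      simpa only [one_smul, he, cfc_const_one ℝ A, hΨ1] using hsum fun _ => 1
    have hPA : ∑ k, t k • P k = Ψ A := by
      have he (x : ℝ) : ∑ k, t k * e k x = x := by
        have hsmul := congrArg (Polynomial.eval (x / M)) (bernsteinPolynomial.sum_smul ℝ n)
        simp only [Polynomial.eval_finsetSum, nsmul_eq_mul, Polynomial.eval_mul,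
          Polynomial.eval_natCast, Polynomial.eval_X] at hsmul
        rw [← Fin.sum_univ_eq_sum_range
          fun k => (k : ℝ) * (bernsteinPolynomial ℝ n k).eval (x / M)] at hsmul
        calc ∑ k, t k * e k x
            = M / n * ∑ k : Fin (n + 1), (k : ℝ) * (bernsteinPolynomial ℝ n k).eval (x / M) := by
              rw [Finset.mul_sum]
              exact Finset.sum_congr rfl fun k _ => by simp only [t, e]; ring
          _ = x := by rw [hsmul]; field_simp
      rw [hsum t]
      simp only [he, cfc_id' ℝ A]
    have hPf : ∑ k, f (t k) • P k ≤ Ψ (cfc f A) + algebraMap ℝ (K →L[ℂ] K) ε := by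
      have hle : cfc (fun x => ∑ k, f (t k) * e k x) A ≤ cfc (fun x => f x + ε) A := by
        refine cfc_mono (fun x hx => ?_) (by fun_prop) (by fun_prop)
        have hx' := (ContinuousMap.dist_lt_iff hε).1 hn ⟨x / M, hAM x hx⟩
        rw [bernsteinApproximation.apply, Real.dist_eq] at hx'
        have hgx : g ⟨x / M, hAM x hx⟩ = f x := congrArg f (mul_div_cancel₀ x hM.ne')
        have hsum_eq : ∑ k : Fin (n + 1), bernstein n k ⟨x / M, hAM x hx⟩ • g (bernstein.z k) =
            ∑ k, f (t k) * e k x :=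
          Finset.sum_congr rfl fun k _ => mul_comm _ _
        rw [hgx, hsum_eq] at hx'
        linarith [(abs_lt.1 hx').2]
      rw [hsum fun k => f (t k)]
      refine (hmono hle).trans_eq ?_
      rw [cfc_add_const ε f A, map_add, Algebra.algebraMap_eq_smul_one,
        Algebra.algebraMap_eq_smul_one, LinearMap.map_smul_of_tower, hΨ1]
    have key := hf.cfc_sum_conj_le hf_cont (fun k => opSqrt (P k))
      (fun k => algebraMap ℝ (K →L[ℂ] K) (t k)) (fun k => by
        rw [Algebra.algebraMap_eq_smul_one]
        exact smul_nonneg (by positivity) zero_le_one)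
      (by simpa only [isSelfAdjoint_opSqrt.star_eq, opSqrt_mul_opSqrt (hP _)] using hP1)
    have hconj (k : Fin (n + 1)) (c : ℝ) :
        star (opSqrt (P k)) * algebraMap ℝ (K →L[ℂ] K) c * opSqrt (P k) = c • P k := by
      rw [isSelfAdjoint_opSqrt.star_eq, ← Algebra.commutes, mul_assoc, opSqrt_mul_opSqrt (hP k),
        Algebra.smul_def]
    simp only [cfc_algebraMap, hconj, hPA] at key
    exact key.trans hPf
  have hlim : Filter.Tendsto (fun ε : ℝ => Ψ (cfc f A) + algebraMap ℝ (K →L[ℂ] K) ε)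
      (nhdsWithin 0 (Set.Ioi 0)) (nhds (Ψ (cfc f A))) := by
    have : Continuous fun ε : ℝ => Ψ (cfc f A) + algebraMap ℝ (K →L[ℂ] K) ε := by fun_prop
    simpa using (this.tendsto 0).mono_left nhdsWithin_le_nhds
  exact ge_of_tendsto hlim (Filter.eventually_of_mem self_mem_nhdsWithin happrox)

/-- A positive linear map dominates the perspective of an operator convex function. -/
theorem OperatorConvexOn.persp_map_le {K : Type} [NormedAddCommGroup K] [InnerProductSpace ℂ K]
    [CompleteSpace K] {f : ℝ → ℝ} (hf : OperatorConvexOn f)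
    (hf_cont : ContinuousOn f (Set.Ici 0)) (Φ : (H →L[ℂ] H) →ₗ[ℂ] (K →L[ℂ] K))
    (hΦ : ∀ T, 0 ≤ T → 0 ≤ Φ T) (hu : IsUnit (Φ 1)) {A : H →L[ℂ] H} (hA : 0 ≤ A) :
    persp f (Φ A) (Φ 1) ≤ Φ (cfc f A) := by
  have h1 : 0 ≤ Φ 1 := hΦ 1 zero_le_one
  let Ψ : (H →L[ℂ] H) →ₗ[ℂ] (K →L[ℂ] K) :=
    LinearMap.mulRight ℂ (opInvSqrt (Φ 1)) ∘ₗ LinearMap.mulLeft ℂ (opInvSqrt (Φ 1)) ∘ₗ Φ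
  have key := hf.cfc_map_le hf_cont Ψ
    (fun T hT => isSelfAdjoint_opInvSqrt.conjugate_nonneg (hΦ T hT))
    (opInvSqrt_mul_self_mul_opInvSqrt h1 hu) hA
  have := isSelfAdjoint_opSqrt (R := Φ 1).conjugate_le_conjugate key
  refine this.trans_eq ?_
  exact opSqrt_mul_opInvSqrt_conj h1 hu _

/-- Refinement of the Choi–Davis–Jensen inequality: for positive linear maps `Φ i` with
`∑ i, Φ i 1 = 1` and a partition `{1,…,n} = S₁ ∪ S₂` with `D_k = ∑ i ∈ S_k, Φ i 1`:
`f(∑ Φ i (A i)) ≤ g(∑_{S₁} Φ i (A i), D₁) + g(∑_{S₂} Φ i (A i), D₂)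
  ≤ ∑ i, g(Φ i (A i), Φ i 1) ≤ ∑ i, Φ i (f (A i))`. -/
theorem stmt_14 {K : Type} [NormedAddCommGroup K] [InnerProductSpace ℂ K] [CompleteSpace K]
    (f : ℝ → ℝ) (hf_cont : ContinuousOn f (Set.Ici (0 : ℝ)))
    (hf : OperatorConvexOn f) (n : ℕ)
    (Φ : Fin n → (H →L[ℂ] H) →ₗ[ℂ] (K →L[ℂ] K))
    (hΦpos : ∀ i (A : H →L[ℂ] H), 0 ≤ A → 0 ≤ Φ i A)
    (hΦsum : ∑ i, Φ i 1 = 1) (hΦunit : ∀ i, IsUnit (Φ i 1))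
    (A : Fin n → H →L[ℂ] H) (hA : ∀ i, 0 ≤ A i)
    (S₁ S₂ : Finset (Fin n)) (hdisj : Disjoint S₁ S₂) (hcover : S₁ ∪ S₂ = Finset.univ)
    (hne₁ : S₁.Nonempty) (hne₂ : S₂.Nonempty)
    (hD₁ : IsUnit (∑ i ∈ S₁, Φ i 1)) (hD₂ : IsUnit (∑ i ∈ S₂, Φ i 1)) :
    cfc f (∑ i, Φ i (A i)) ≤
        persp f (∑ i ∈ S₁, Φ i (A i)) (∑ i ∈ S₁, Φ i 1) +
          persp f (∑ i ∈ S₂, Φ i (A i)) (∑ i ∈ S₂, Φ i 1) ∧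
      persp f (∑ i ∈ S₁, Φ i (A i)) (∑ i ∈ S₁, Φ i 1) +
          persp f (∑ i ∈ S₂, Φ i (A i)) (∑ i ∈ S₂, Φ i 1) ≤
        ∑ i, persp f (Φ i (A i)) (Φ i 1) ∧
      (∑ i, persp f (Φ i (A i)) (Φ i 1)) ≤ ∑ i, Φ i (cfc f (A i)) := by
  have hΦ1 (i : Fin n) : 0 ≤ Φ i 1 := hΦpos i 1 zero_le_one
  have hL (i : Fin n) : 0 ≤ Φ i (A i) := hΦpos i _ (hA i)
  have hsplit (g : Fin n → K →L[ℂ] K) : ∑ i, g i = ∑ i ∈ S₁, g i + ∑ i ∈ S₂, g i := by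
    rw [← hcover, Finset.sum_union hdisj]
  refine ⟨?_, ?_, Finset.sum_le_sum fun i _ =>
    hf.persp_map_le hf_cont (Φ i) (hΦpos i) (hΦunit i) (hA i)⟩
  · have key := hf.persp_sum_le hf_cont Finset.univ
      (fun b : Bool => bif b then ∑ i ∈ S₁, Φ i (A i) else ∑ i ∈ S₂, Φ i (A i))
      (fun b : Bool => bif b then ∑ i ∈ S₁, Φ i 1 else ∑ i ∈ S₂, Φ i 1)
      (by rintro (_ | _) <;> exact Finset.sum_nonneg fun i _ => hL i)
      (by rintro (_ | _) <;> exact Finset.sum_nonneg fun i _ => hΦ1 i)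
      (by rintro (_ | _) <;> assumption)
    simp only [Fintype.sum_bool, cond_true, cond_false, ← hsplit, hΦsum] at key
    simpa only [persp_one] using key isUnit_one
  · rw [hsplit]
    exact add_le_add (hf.persp_sum_le hf_cont S₁ _ _ hL hΦ1 hΦunit hD₁)
      (hf.persp_sum_le hf_cont S₂ _ _ hL hΦ1 hΦunit hD₂)
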